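/- arXiv:1312.2223 — 4 statements merged into one kernel-verified Lean document; each statement's English description precedes it below -/
import Mathlib

section
/- Let L be a Lie ring, let n ≥ 1, and let x₁, …, xₙ, y ∈ L. Then ⁅[x₁,…,xₙ], y⁆ = Σ_α (−1)^{h(α)} [x_{α(1)}, …, x_{α(n)}, y], where the sum runs over all unimodal permutations α of {1,…,n} (i.e. there is some s with α(i) < α(i+1) for all i < s and α(i) > α(i+1) for all i with s ≤ i < n; necessarily α(s) = n) and h(α) = n − s. -/
open scoped Classical

/-- The right-normed bracket `[x₁,…,xₙ] = ⁅x₁, [x₂,…,xₙ]⁆` of a list of elements of a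
Lie ring, with the conventions `[x] = x` and `[] = 0`. -/
def rightBracket {L : Type*} [LieRing L] : List L → L
  | [] => 0
  | [x] => x
  | x :: y :: ys => ⁅x, rightBracket (y :: ys)⁆

/-- A permutation `α` of `{0,…,n-1}` is unimodal with peak at (0-based) position `p` if
`α j < α (j+1)` for all `j < p` and `α (j+1) < α j` for all `j ≥ p`.  (In the 1-based
indexing of the paper this is the peak position `s = p + 1`, and `h(α) = n - s = n - 1 - p`.) -/
def IsUnimodalPeak {n : ℕ} (α : Equiv.Perm (Fin n)) (p : ℕ) : Prop :=
  p < n ∧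
  (∀ (j : ℕ) (hj : j + 1 < n), j < p →
      α ⟨j, Nat.lt_of_succ_lt hj⟩ < α ⟨j + 1, hj⟩) ∧
  (∀ (j : ℕ) (hj : j + 1 < n), p ≤ j →
      α ⟨j + 1, hj⟩ < α ⟨j, Nat.lt_of_succ_lt hj⟩)


theorem rb_cons {L : Type*} [LieRing L] (a : L) (l : List L) (h : l ≠ []) :
    rightBracket (a :: l) = ⁅a, rightBracket l⁆ := by
  cases l with
  | nil => exact absurd rfl h
  | cons b l => rfl

theorem rb_snoc {L : Type*} [LieRing L] (a y : L) (l : List L) :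
    rightBracket (l ++ [a] ++ [y]) = rightBracket (l ++ [⁅a, y⁆]) := by
  induction l with
  | nil => rfl
  | cons b l ih =>
    simp only [List.cons_append] at ih ⊢
    rw [rb_cons _ _ (by simp), rb_cons _ _ (by simp), ih]

/-- Extend a permutation by fixing 0. -/
def extA {n : ℕ} (σ : Equiv.Perm (Fin (n+1))) : Equiv.Perm (Fin (n+2)) :=
  Equiv.Perm.decomposeFin.symm (0, σ)

/-- Extend a permutation by sending the last position to 0. -/
def extB {n : ℕ} (σ : Equiv.Perm (Fin (n+1))) : Equiv.Perm (Fin (n+2)) :=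
  (finRotate (n+2)).trans (extA σ)

theorem extA_zero {n : ℕ} (σ : Equiv.Perm (Fin (n+1))) : extA σ 0 = 0 := by
  simp [extA]

theorem extA_succ {n : ℕ} (σ : Equiv.Perm (Fin (n+1))) (i : Fin (n+1)) :
    extA σ i.succ = (σ i).succ := by
  simp [extA]

theorem extB_last {n : ℕ} (σ : Equiv.Perm (Fin (n+1))) : extB σ (Fin.last _) = 0 := by
  simp [extB, extA_zero]

theorem extB_castSucc {n : ℕ} (σ : Equiv.Perm (Fin (n+1))) (i : Fin (n+1)) :
    extB σ i.castSucc = (σ i).succ := by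
  rw [← extA_succ]
  simp only [extB, Equiv.trans_apply]
  congr 1
  simp

theorem extA_inj {n : ℕ} : Function.Injective (extA (n := n)) := by
  intro a b h
  have := Equiv.Perm.decomposeFin.symm.injective h
  simpa using this

theorem extB_inj {n : ℕ} : Function.Injective (extB (n := n)) := by
  intro a b h
  apply Equiv.ext
  intro i
  have := congrArg (fun e => e i.castSucc) h
  simpa [extB_castSucc] using this

theorem extA_surj {n : ℕ} (τ : Equiv.Perm (Fin (n+2))) (h : τ 0 = 0) : ∃ σ, extA σ = τ := by
  obtain ⟨⟨p, σ⟩, rfl⟩ := Equiv.Perm.decomposeFin.symm.surjective τ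
  have hp : p = 0 := by simpa using h
  exact ⟨σ, by rw [hp, extA]⟩

theorem extB_surj {n : ℕ} (τ : Equiv.Perm (Fin (n+2))) (h : τ (Fin.last _) = 0) :
    ∃ σ, extB σ = τ := by
  obtain ⟨σ, hσ⟩ := extA_surj ((finRotate (n+2)).symm.trans τ) (by
    have : (finRotate (n+2)).symm 0 = Fin.last _ := by
      rw [Equiv.symm_apply_eq]; simp
    simp only [Equiv.trans_apply, this, h])
  refine ⟨σ, ?_⟩
  rw [extB, hσ]
  ext i
  simp

theorem extA_uni {n : ℕ} (σ : Equiv.Perm (Fin (n+1))) (p : ℕ) :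
    IsUnimodalPeak (extA σ) (p+1) ↔ IsUnimodalPeak σ p := by
  have key : ∀ (j : ℕ) (hj : j + 1 < n + 2),
      extA σ ⟨j + 1, hj⟩ = (σ ⟨j, by omega⟩).succ := fun j hj => extA_succ σ ⟨j, by omega⟩
  constructor
  · rintro ⟨h1, h2, h3⟩
    refine ⟨by omega, fun j hj hp => ?_, fun j hj hp => ?_⟩
    · have := h2 (j+1) (by omega) (by omega)
      rwa [key, key, Fin.succ_lt_succ_iff] at this
    · have := h3 (j+1) (by omega) (by omega)
      rwa [key, key, Fin.succ_lt_succ_iff] at this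
  · rintro ⟨h1, h2, h3⟩
    refine ⟨by omega, fun j hj hp => ?_, fun j hj hp => ?_⟩
    · rcases j with _ | j
      · rw [key]
        have : extA σ ⟨0, by omega⟩ = 0 := extA_zero σ
        rw [this]
        exact Fin.succ_pos _
      · rw [key, key, Fin.succ_lt_succ_iff]
        exact h2 j _ (by omega)
    · rcases j with _ | j
      · omega
      · rw [key, key, Fin.succ_lt_succ_iff]
        exact h3 j _ (by omega)

theorem extB_uni {n : ℕ} (σ : Equiv.Perm (Fin (n+1))) (p : ℕ) (hpn : p < n + 1) :
    IsUnimodalPeak (extB σ) p ↔ IsUnimodalPeak σ p := by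
  have key : ∀ (j : ℕ) (hj : j < n + 1),
      extB σ ⟨j, by omega⟩ = (σ ⟨j, hj⟩).succ := fun j hj => extB_castSucc σ ⟨j, by omega⟩
  constructor
  · rintro ⟨h1, h2, h3⟩
    refine ⟨by omega, fun j hj hp => ?_, fun j hj hp => ?_⟩
    · have := h2 j (by omega) (by omega)
      rwa [key _ (by omega), key _ (by omega), Fin.succ_lt_succ_iff] at this
    · have := h3 j (by omega) (by omega)
      rwa [key _ (by omega), key _ (by omega), Fin.succ_lt_succ_iff] at this
  · rintro ⟨h1, h2, h3⟩
    refine ⟨by omega, fun j hj hp => ?_, fun j hj hp => ?_⟩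
    · rw [key _ (by omega), key _ (by omega), Fin.succ_lt_succ_iff]
      exact h2 j _ (by omega)
    · by_cases hjn : j + 1 < n + 1
      · rw [key _ (by omega), key _ (by omega), Fin.succ_lt_succ_iff]
        exact h3 j _ (by omega)
      · obtain rfl : j = n := by omega
        rw [key j (by omega)]
        have : extB σ ⟨j + 1, hj⟩ = 0 := extB_last σ
        rw [this]
        exact Fin.succ_pos _

theorem uni_zero_peak {n : ℕ} (τ : Equiv.Perm (Fin (n+2))) (p : ℕ) (h : IsUnimodalPeak τ p)
    (h0 : τ 0 = 0) : p ≠ 0 := by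
  rintro rfl
  have : τ _ < τ 0 := h.2.2 0 (by omega) le_rfl
  rw [h0] at this
  exact absurd this (Fin.not_lt_zero _)

theorem uni_last_peak {n : ℕ} (τ : Equiv.Perm (Fin (n+2))) (p : ℕ) (h : IsUnimodalPeak τ p)
    (h0 : τ (Fin.last _) = 0) : p < n + 1 := by
  by_contra hp
  have : _ < τ (Fin.last _) := h.2.1 n (by omega) (by omega)
  rw [h0] at this
  exact absurd this (Fin.not_lt_zero _)

theorem uni_cases {n : ℕ} (τ : Equiv.Perm (Fin (n+2))) (p : ℕ) (h : IsUnimodalPeak τ p)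
    (h0 : τ 0 ≠ 0) : τ (Fin.last _) = 0 := by
  obtain ⟨⟨i, hi⟩, hi0⟩ := τ.surjective 0
  rcases i with _ | i
  · exact absurd hi0 h0
  by_cases hin : i = n
  · subst hin; exact hi0
  exfalso
  by_cases hp : i < p
  · have := h.2.1 i hi hp
    rw [hi0] at this
    exact absurd this (Fin.not_lt_zero _)
  · have := h.2.2 (i+1) (by omega) (by omega)
    rw [hi0] at this
    exact absurd this (Fin.not_lt_zero _)

theorem main_aux {L : Type*} [LieRing L] (n : ℕ) : ∀
    (x : Fin (n+1) → L) (y : L),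
    ⁅rightBracket (List.ofFn x), y⁆ =
      ∑ σ ∈ Finset.univ.filter
          (fun σ : Equiv.Perm (Fin (n+1)) × Fin (n+1) => IsUnimodalPeak σ.1 σ.2.val),
        ((-1 : ℤ) ^ (n - σ.2.val)) •
          rightBracket (List.ofFn (fun i => x (σ.1 i)) ++ [y]) := by
  induction n with
  | zero =>
    intro x y
    rw [Finset.filter_true_of_mem]
    · haveI : Subsingleton (Fin (0 + 1)) := inferInstanceAs (Subsingleton (Fin 1))
      rw [Fintype.sum_subsingleton _ (1, 0)]
      simp [rightBracket]
    · intro σ _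
      exact ⟨σ.2.2, fun j hj => by omega, fun j hj => by omega⟩
  | succ n ih =>
    intro x y
    rw [List.ofFn_succ, rb_cons _ _ (by simp), lie_lie, ih, ih, lie_sum, sub_eq_add_neg,
      ← Finset.sum_neg_distrib,
      ← Finset.sum_filter_add_sum_filter_not (Finset.univ.filter _)
        (fun σ : Equiv.Perm (Fin (n+2)) × Fin (n+2) => σ.1 0 = 0)]
    congr 1
    · refine Finset.sum_bij (fun σ _ => (extA σ.1, σ.2.succ)) ?_ ?_ ?_ ?_
      · intro σ hσ
        simp only [Finset.mem_filter, Finset.mem_univ, true_and] at hσ ⊢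
        exact ⟨(extA_uni _ _).2 hσ, extA_zero _⟩
      · rintro ⟨a, p⟩ _ ⟨b, q⟩ _ h
        simp only [Prod.mk.injEq, Fin.succ_inj] at h
        rw [extA_inj h.1, h.2]
      · rintro ⟨τ, p⟩ h
        simp only [Finset.mem_filter, Finset.mem_univ, true_and] at h
        obtain ⟨h, h0⟩ := h
        obtain ⟨σ, rfl⟩ := extA_surj τ h0
        have hp := uni_zero_peak _ _ h h0
        obtain ⟨q, rfl⟩ := Fin.exists_succ_eq.2 (fun e : p = 0 => hp (by rw [e]; rfl))
        refine ⟨(σ, q), ?_, rfl⟩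
        simp only [Finset.mem_filter, Finset.mem_univ, true_and]
        exact (extA_uni _ _).1 h
      · rintro ⟨σ, p⟩ _
        simp only [Fin.val_succ, Nat.add_sub_add_right, lie_zsmul]
        rw [List.ofFn_succ (n := n+1), List.cons_append, rb_cons _ _ (by simp), extA_zero]
        simp only [extA_succ]
    · refine Finset.sum_bij (fun σ _ => (extB σ.1, σ.2.castSucc)) ?_ ?_ ?_ ?_
      · intro σ hσ
        simp only [Finset.mem_filter, Finset.mem_univ, true_and] at hσ ⊢
        refine ⟨(extB_uni _ _ σ.2.2).2 hσ, ?_⟩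
        have : extB σ.1 0 = _ := extB_castSucc σ.1 0
        rw [this]
        exact Fin.succ_ne_zero _
      · rintro ⟨a, p⟩ _ ⟨b, q⟩ _ h
        simp only [Prod.mk.injEq, Fin.castSucc_inj] at h
        rw [extB_inj h.1, h.2]
      · rintro ⟨τ, p⟩ h
        simp only [Finset.mem_filter, Finset.mem_univ, true_and] at h
        obtain ⟨h, h0⟩ := h
        have h1 := uni_cases _ _ h h0
        obtain ⟨σ, rfl⟩ := extB_surj τ h1
        have hp := uni_last_peak _ _ h h1
        refine ⟨(σ, ⟨p, hp⟩), ?_, rfl⟩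
        simp only [Finset.mem_filter, Finset.mem_univ, true_and]
        exact (extB_uni _ _ hp).1 h
      · rintro ⟨σ, p⟩ _
        have hp := p.2
        have e : n + 1 - p.val = (n - p.val) + 1 := by omega
        simp only [Fin.val_castSucc, e]
        rw [List.ofFn_succ' (n := n+1), List.concat_eq_append, rb_snoc, extB_last]
        simp only [extB_castSucc, pow_succ, mul_neg, mul_one, neg_smul]

/-- For a Lie ring `L`, `n ≥ 1` and `x₁,…,xₙ, y ∈ L`,
`⁅[x₁,…,xₙ], y⁆ = Σ_α (−1)^{h(α)} [x_{α(1)},…,x_{α(n)}, y]`, the sum running over all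
unimodal permutations `α` of `{1,…,n}` with peak at position `s` and `h(α) = n − s`. -/
theorem lie_rightBracket_eq_sum_unimodal {L : Type*} [LieRing L] (n : ℕ) (hn : 1 ≤ n)
    (x : Fin n → L) (y : L) :
    ⁅rightBracket (List.ofFn x), y⁆ =
      ∑ σ ∈ Finset.univ.filter
          (fun σ : Equiv.Perm (Fin n) × Fin n => IsUnimodalPeak σ.1 σ.2.val),
        ((-1 : ℤ) ^ (n - 1 - σ.2.val)) •
          rightBracket (List.ofFn (fun i => x (σ.1 i)) ++ [y]) := by
  obtain ⟨m, rfl⟩ : ∃ m, n = m + 1 := ⟨n - 1, by omega⟩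
  simpa only [Nat.add_sub_cancel] using main_aux m x y
end

section
/- Let k be a field, l a Lie algebra over k, h a Lie subalgebra of l, and s a vector subspace of l such that l = h ⊕ s as vector spaces; let π : l → s be the linear projection onto s with kernel h. For n ≥ 1 and x₁,…,xₙ ∈ s define (x₁,…,xₙ) := π(⁅x₁, ⁅x₂, …, ⁅x_{n−1}, xₙ⁆…⁆⁆) (so (x) = x). Then for all n, m ≥ 1 and all x₁,…,xₙ, y₁,…,y_m ∈ s: −((x₁,…,xₙ), (y₁,…,y_m)) + ((x₁,…,xₙ), y₁,…,y_m) − ((y₁,…,y_m), x₁,…,xₙ) = Σ_α (−1)^{h(α)} (x_{α(1)},…,x_{α(n)}, y₁,…,y_m), where the sum runs over all unimodal permutations α of {1,…,n} with peak at some position s₀ and h(α) = n − s₀. -/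
open scoped Classical

namespace UniAux

/-- iterated left action -/
def act {L : Type*} [LieRing L] (xs : List L) (z : L) : L := xs.foldr (fun a b => ⁅a, b⁆) z

theorem rb_cons {L : Type*} [LieRing L] (a : L) (ys : List L) (h : ys ≠ []) :
    rightBracket (a :: ys) = ⁅a, rightBracket ys⁆ := by
  cases ys with
  | nil => exact absurd rfl h
  | cons b t => rfl

theorem rb_append {L : Type*} [LieRing L] (xs ys : List L) (h : ys ≠ []) :
    rightBracket (xs ++ ys) = act xs (rightBracket ys) := by
  induction xs with
  | nil => rfl
  | cons a t ih =>
    rw [List.cons_append, rb_cons _ _ (by simp [h]), ih]; rfl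

def pre {n : ℕ} (a : Equiv.Perm (Fin n)) : Equiv.Perm (Fin (n + 1)) :=
  Equiv.Perm.decomposeFin.symm (0, a)

def app {n : ℕ} (a : Equiv.Perm (Fin n)) : Equiv.Perm (Fin (n + 1)) :=
  (finRotate (n + 1)).trans (pre a)

theorem pre_zero {n : ℕ} (a : Equiv.Perm (Fin n)) : pre a 0 = 0 := by
  simp [pre]

theorem pre_succ {n : ℕ} (a : Equiv.Perm (Fin n)) (i : Fin n) : pre a i.succ = (a i).succ := by
  simp [pre]

theorem app_last {n : ℕ} (a : Equiv.Perm (Fin n)) : app a (Fin.last n) = 0 := by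
  simp [app, pre_zero]

theorem app_castSucc {n : ℕ} (a : Equiv.Perm (Fin n)) (i : Fin n) :
    app a i.castSucc = (a i).succ := by
  simp [app, pre_succ]

theorem pre_inj {n : ℕ} : Function.Injective (pre (n := n)) := by
  intro a b h
  have := Equiv.Perm.decomposeFin.symm.injective h
  simpa using this

theorem app_inj {n : ℕ} : Function.Injective (app (n := n)) := by
  intro a b h
  apply pre_inj
  ext i
  have := DFunLike.congr_fun h ((finRotate (n + 1)).symm i)
  simpa [app] using congrArg Fin.val this

theorem exists_pre {n : ℕ} (a : Equiv.Perm (Fin (n + 1))) (h : a 0 = 0) : ∃ b, a = pre b := by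
  obtain ⟨⟨p, b⟩, rfl⟩ := Equiv.Perm.decomposeFin.symm.surjective a
  simp at h
  subst h
  exact ⟨b, rfl⟩

theorem exists_app {n : ℕ} (a : Equiv.Perm (Fin (n + 1))) (h : a (Fin.last n) = 0) :
    ∃ b, a = app b := by
  obtain ⟨b, hb⟩ := exists_pre ((finRotate (n + 1)).symm.trans a) (by
    have : (finRotate (n + 1)).symm 0 = Fin.last n := by
      rw [Equiv.symm_apply_eq]; simp
    simp only [Equiv.trans_apply, this, h])
  refine ⟨b, ?_⟩
  rw [app, ← hb]
  ext i; simp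

theorem uni_pre {n : ℕ} (a : Equiv.Perm (Fin (n + 1))) (p : ℕ) :
    IsUnimodalPeak (pre a) (p + 1) ↔ IsUnimodalPeak a p := by
  have e : ∀ j (hj : j + 1 < n + 1 + 1), pre a ⟨j + 1, hj⟩ = (a ⟨j, by omega⟩).succ :=
    fun j hj => pre_succ a ⟨j, by omega⟩
  unfold IsUnimodalPeak
  refine and_congr (by omega) (and_congr ⟨fun H j hj hp => ?_, fun H j hj hp => ?_⟩
    ⟨fun H j hj hp => ?_, fun H j hj hp => ?_⟩)
  · have := H (j + 1) (by omega) (by omega)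
    rwa [e, e, Fin.succ_lt_succ_iff] at this
  · rw [e]
    cases j with
    | zero => rw [show (⟨0, _⟩ : Fin (n + 1 + 1)) = 0 from rfl, pre_zero]; exact Fin.succ_pos _
    | succ j => rw [e, Fin.succ_lt_succ_iff]; exact H j (by omega) (by omega)
  · have := H (j + 1) (by omega) (by omega)
    rwa [e, e, Fin.succ_lt_succ_iff] at this
  · cases j with
    | zero => omega
    | succ j => rw [e, e, Fin.succ_lt_succ_iff]; exact H j (by omega) (by omega)

theorem uni_app {n : ℕ} (a : Equiv.Perm (Fin (n + 1))) (p : ℕ) (hpn : p < n + 1) :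
    IsUnimodalPeak (app a) p ↔ IsUnimodalPeak a p := by
  have e : ∀ j (hj : j < n + 1), app a ⟨j, by omega⟩ = (a ⟨j, hj⟩).succ :=
    fun j hj => app_castSucc a ⟨j, hj⟩
  unfold IsUnimodalPeak
  refine and_congr (by omega) (and_congr ⟨fun H j hj hp => ?_, fun H j hj hp => ?_⟩
    ⟨fun H j hj hp => ?_, fun H j hj hp => ?_⟩)
  · have := H j (by omega) hp
    rwa [e _ (by omega), e _ (by omega), Fin.succ_lt_succ_iff] at this
  · rw [e _ (by omega), e _ (by omega), Fin.succ_lt_succ_iff]; exact H j (by omega) hp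
  · have := H j (by omega) hp
    rwa [e _ (by omega), e _ (by omega), Fin.succ_lt_succ_iff] at this
  · by_cases hjn : j + 1 < n + 1
    · rw [e _ (by omega), e _ (by omega), Fin.succ_lt_succ_iff]; exact H j (by omega) hp
    · obtain rfl : j = n := by omega
      rw [e j (by omega), show (⟨j + 1, hj⟩ : Fin (j + 1 + 1)) = Fin.last _ from rfl, app_last]
      exact Fin.succ_pos _

theorem uni_cases {n : ℕ} (a : Equiv.Perm (Fin (n + 2))) (p : ℕ) (H : IsUnimodalPeak a p) :
    (a 0 = 0 ∧ 1 ≤ p) ∨ (a (Fin.last (n + 1)) = 0 ∧ p < n + 1) := by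
  obtain ⟨hp, h1, h2⟩ := H
  obtain ⟨⟨j, hj⟩, hj0⟩ := a.surjective 0
  rcases Nat.eq_zero_or_pos j with rfl | hpos
  · left
    refine ⟨hj0, ?_⟩
    by_contra hc
    have := h2 0 (by omega) (by omega)
    rw [hj0] at this
    exact absurd this (Fin.not_lt_zero _)
  · obtain ⟨i, rfl⟩ : ∃ i, j = i + 1 := ⟨j - 1, by omega⟩
    have hpi : p ≤ i := by
      by_contra hc
      have := h1 i (by omega) (by omega)
      rw [hj0] at this
      exact absurd this (Fin.not_lt_zero _)
    by_cases hl : i + 1 < n + 1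
    · have := h2 (i + 1) (by omega) (by omega)
      rw [hj0] at this
      exact absurd this (Fin.not_lt_zero _)
    · obtain rfl : i = n := by omega
      exact Or.inr ⟨hj0, by omega⟩

noncomputable def U (n : ℕ) : Finset (Equiv.Perm (Fin n) × Fin n) :=
  Finset.univ.filter (fun σ : Equiv.Perm (Fin n) × Fin n => IsUnimodalPeak σ.1 σ.2.val)

theorem U_succ (n : ℕ) : U (n + 2) =
    (U (n + 1)).image (fun σ => (pre σ.1, σ.2.succ)) ∪
    (U (n + 1)).image (fun σ => (app σ.1, σ.2.castSucc)) := by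
  ext ⟨a, p⟩
  simp only [U, Finset.mem_filter, Finset.mem_univ, true_and, Finset.mem_union, Finset.mem_image,
    Prod.exists, Prod.mk.injEq]
  constructor
  · intro H
    rcases uni_cases a p H with ⟨h0, hp⟩ | ⟨h0, hp⟩
    · left
      obtain ⟨b, rfl⟩ := exists_pre a h0
      obtain ⟨q, rfl⟩ := Fin.exists_succ_eq.2 (show p ≠ 0 by rintro rfl; simp at hp)
      exact ⟨b, q, (uni_pre b q).1 H, rfl, rfl⟩
    · right
      obtain ⟨b, rfl⟩ := exists_app a h0
      exact ⟨b, ⟨p, hp⟩, (uni_app b p hp).1 H, rfl, rfl⟩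
  · rintro (⟨b, q, H, rfl, rfl⟩ | ⟨b, q, H, rfl, rfl⟩)
    · exact (uni_pre b q).2 H
    · exact (uni_app b q q.2).2 H

theorem U_disj (n : ℕ) : Disjoint
    ((U (n + 1)).image (fun σ => (pre σ.1, σ.2.succ)))
    ((U (n + 1)).image (fun σ => (app σ.1, σ.2.castSucc))) := by
  rw [Finset.disjoint_left]
  rintro ⟨a, p⟩ h1 h2
  simp only [Finset.mem_image, Prod.exists, Prod.mk.injEq] at h1 h2
  obtain ⟨b, q, -, hb, -⟩ := h1
  obtain ⟨c, r, -, hc, -⟩ := h2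
  have e1 : a 0 = 0 := by rw [← hb, pre_zero]
  have e2 : a (Fin.last (n + 1)) = 0 := by rw [← hc, app_last]
  have := a.injective (e1.trans e2.symm)
  simp [Fin.ext_iff] at this

theorem key {L : Type*} [LieRing L] (n : ℕ) (x : Fin (n + 1) → L) (z : L) :
    ⁅rightBracket (List.ofFn x), z⁆ =
    ∑ σ ∈ U (n + 1), ((-1 : ℤ) ^ (n - σ.2.val)) • act (List.ofFn (fun i => x (σ.1 i))) z := by
  induction n generalizing z with
  | zero =>
    have : U (0 + 1) = {(1, 0)} := by
      ext ⟨a, p⟩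
      simp only [U, Finset.mem_filter, Finset.mem_univ, true_and, Finset.mem_singleton]
      constructor
      · intro _; exact Prod.ext (Equiv.ext fun i => Subsingleton.elim (α := Fin 1) _ _) (Subsingleton.elim (α := Fin 1) _ _)
      · intro _; exact ⟨p.2, fun j hj => by omega, fun j hj => by omega⟩
    rw [this]
    simp [act, rightBracket]
  | succ n ih =>
    rw [List.ofFn_succ, rb_cons _ _ (by simp), lie_lie, U_succ, Finset.sum_union (U_disj n),
      Finset.sum_image, Finset.sum_image]
    · have A : ∀ σ ∈ U (n + 1), ((-1 : ℤ) ^ (n + 1 - (σ.2.succ).val)) •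
          act (List.ofFn (fun i => x (pre σ.1 i))) z =
          ⁅x 0, ((-1 : ℤ) ^ (n - σ.2.val)) • act (List.ofFn (fun i => x (σ.1 i).succ)) z⁆ := by
        intro σ _
        rw [List.ofFn_succ, lie_zsmul]
        simp only [pre_zero, pre_succ, Fin.val_succ, Nat.add_sub_add_right]
        rfl
      have B : ∀ σ ∈ U (n + 1), ((-1 : ℤ) ^ (n + 1 - (σ.2.castSucc).val)) •
          act (List.ofFn (fun i => x (app σ.1 i))) z =
          - (((-1 : ℤ) ^ (n - σ.2.val)) • act (List.ofFn (fun i => x (σ.1 i).succ)) ⁅x 0, z⁆) := by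
        intro σ _
        rw [List.ofFn_succ_last]
        simp only [app_last, app_castSucc, Fin.val_castSucc]
        rw [show n + 1 - σ.2.val = (n - σ.2.val) + 1 by have := σ.2.2; omega, pow_succ]
        simp [act]
      rw [Finset.sum_congr rfl A, Finset.sum_congr rfl B, ← lie_sum, Finset.sum_neg_distrib,
        ← ih (fun i => x i.succ), ← ih (fun i => x i.succ)]
      rw [sub_eq_add_neg]
    · rintro ⟨a, p⟩ _ ⟨b, q⟩ _ h
      simp only [Prod.mk.injEq] at h
      rw [app_inj h.1, Fin.castSucc_injective _ h.2]
    · rintro ⟨a, p⟩ _ ⟨b, q⟩ _ h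
      simp only [Prod.mk.injEq] at h
      rw [pre_inj h.1, Fin.succ_injective _ h.2]

end UniAux

/-- Let `l = h ⊕ s` be a Lie algebra decomposed as the direct sum of a Lie subalgebra `h`
and a subspace `s`, and let `π` be the projection onto `s` along `h`.  Defining
`(x₁,…,xₙ) = π [x₁,…,xₙ]` (the projection of the right-normed bracket), for all
`n, m ≥ 1` and `x₁,…,xₙ, y₁,…,y_m ∈ s` one has
`−((x₁,…,xₙ),(y₁,…,y_m)) + ((x₁,…,xₙ), y₁,…,y_m) − ((y₁,…,y_m), x₁,…,xₙ)
  = Σ_α (−1)^{h(α)} (x_{α(1)},…,x_{α(n)}, y₁,…,y_m)`,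
the sum running over all unimodal permutations of `{1,…,n}`. -/
theorem proj_iterated_bracket_identity {k : Type*} [Field k] {l : Type*}
    [LieRing l] [LieAlgebra k l]
    (h : LieSubalgebra k l) (s : Submodule k l)
    (hcompl : IsCompl h.toSubmodule s)
    (π : l →ₗ[k] l)
    (hπ_mem : ∀ z : l, π z ∈ s)
    (hπ_s : ∀ z ∈ s, π z = z)
    (hπ_h : ∀ z ∈ h, π z = 0)
    (n m : ℕ) (hn : 1 ≤ n) (hm : 1 ≤ m)
    (x : Fin n → l) (hx : ∀ i, x i ∈ s)
    (y : Fin m → l) (hy : ∀ i, y i ∈ s) :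
    - π ⁅π (rightBracket (List.ofFn x)), π (rightBracket (List.ofFn y))⁆
      + π (rightBracket (π (rightBracket (List.ofFn x)) :: List.ofFn y))
      - π (rightBracket (π (rightBracket (List.ofFn y)) :: List.ofFn x))
    = ∑ σ ∈ Finset.univ.filter
          (fun σ : Equiv.Perm (Fin n) × Fin n => IsUnimodalPeak σ.1 σ.2.val),
        ((-1 : ℤ) ^ (n - 1 - σ.2.val)) •
          π (rightBracket (List.ofFn (fun i => x (σ.1 i)) ++ List.ofFn y)) := by
  have hX : ∀ z, z - π z ∈ h := by
    intro z
    have hz : z ∈ h.toSubmodule ⊔ s := by rw [hcompl.sup_eq_top]; trivial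
    obtain ⟨a, ha, b, hb, rfl⟩ := Submodule.mem_sup.1 hz
    rw [map_add, hπ_h a ha, hπ_s b hb]
    simpa using ha
  have hyne : List.ofFn y ≠ [] := by
    rw [Ne, List.ofFn_eq_nil_iff]; omega
  have hxne : List.ofFn x ≠ [] := by
    rw [Ne, List.ofFn_eq_nil_iff]; omega
  obtain ⟨N, rfl⟩ : ∃ N, n = N + 1 := ⟨n - 1, by omega⟩
  have K := congrArg π (UniAux.key N x (rightBracket (List.ofFn y)))
  simp only [UniAux.rb_append _ _ hyne, UniAux.rb_cons _ _ hyne, UniAux.rb_cons _ _ hxne]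
  rw [map_sum] at K
  simp only [map_zsmul, UniAux.U] at K
  simp only [Nat.add_sub_cancel]
  rw [← K]
  generalize rightBracket (List.ofFn x) = X
  generalize rightBracket (List.ofFn y) = Y
  have := hπ_h _ (h.lie_mem (hX X) (hX Y))
  rw [sub_lie, lie_sub, lie_sub, map_sub, map_sub, map_sub] at this
  rw [← lie_skew (π Y) X, map_neg]
  rw [← sub_eq_zero, ← neg_eq_zero, ← this]
  abel
end

section
/- Let k be a field and s a k-vector space equipped with multilinear operations qₙ (n ≥ 2), with q₁(x) = x, satisfying the envelope identities. Suppose (l₁, h₁, ι₁) and (l₂, h₂, ι₂) are two Lie envelopes of (s, (qₙ)) such that, for each i ∈ {1,2}, the image ιᵢ(s) generates lᵢ as a Lie algebra and the only Lie ideal of lᵢ contained in hᵢ is the zero ideal. Then there exists an isomorphism of Lie algebras φ : l₁ → l₂ with φ ∘ ι₁ = ι₂. -/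
open scoped Classical

/-- The envelope identities for a family of multilinear operations `qₙ` on a vector
space `s`: for all `n, m ≥ 1` and `x₁,…,xₙ, y₁,…,y_m ∈ s`,
`−q₂(qₙ(x), q_m(y)) + q_{m+1}(qₙ(x), y₁,…,y_m) − q_{n+1}(q_m(y), x₁,…,xₙ)
  = Σ_α (−1)^{h(α)} q_{n+m}(x_{α(1)},…,x_{α(n)}, y₁,…,y_m)`,
the sum running over unimodal permutations `α` of `{1,…,n}`. -/
def EnvelopeIdentities (k : Type*) [Field k] (s : Type*) [AddCommGroup s] [Module k s]
    (q : ∀ n : ℕ, MultilinearMap k (fun _ : Fin n => s) s) : Prop :=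
  ∀ (n m : ℕ), 1 ≤ n → 1 ≤ m → ∀ (x : Fin n → s) (y : Fin m → s),
    - q 2 ![q n x, q m y] + q (m + 1) (Fin.cons (q n x) y)
      - q (n + 1) (Fin.cons (q m y) x)
    = ∑ σ ∈ Finset.univ.filter
          (fun σ : Equiv.Perm (Fin n) × Fin n => IsUnimodalPeak σ.1 σ.2.val),
        ((-1 : ℤ) ^ (n - 1 - σ.2.val)) • q (n + m) (Fin.append (fun i => x (σ.1 i)) y)

/-- A Lie envelope of a vector space `s` with multilinear operations `(qₙ)`: a Lie
algebra `carrier` over `k`, with a Lie subalgebra `h`, an injective linear embedding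
`ι : s → carrier` such that `carrier = h ⊕ ι(s)` as vector spaces, and such that the
projection `π` onto `ι(s)` along `h` sends the right-normed bracket
`⁅ι x₁, ⁅…, ⁅ι x_{n-1}, ι xₙ⁆…⁆⁆` to `ι (qₙ(x₁,…,xₙ))`. -/
structure LieEnvelope (k : Type*) [Field k] (s : Type*) [AddCommGroup s] [Module k s]
    (q : ∀ n : ℕ, MultilinearMap k (fun _ : Fin n => s) s) where
  carrier : Type*
  [isLieRing : LieRing carrier]
  [isLieAlgebra : LieAlgebra k carrier]
  h : LieSubalgebra k carrier
  ι : s →ₗ[k] carrier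
  ι_injective : Function.Injective ι
  compl : IsCompl h.toSubmodule (LinearMap.range ι)
  π : carrier →ₗ[k] carrier
  π_mem : ∀ z : carrier, π z ∈ LinearMap.range ι
  π_eq_self : ∀ z ∈ LinearMap.range ι, π z = z
  π_eq_zero : ∀ z ∈ h, π z = 0
  proj_bracket : ∀ (n : ℕ), 1 ≤ n → ∀ x : Fin n → s,
    π (rightBracket (List.ofFn fun i => ι (x i))) = ι (q n x)

attribute [instance] LieEnvelope.isLieRing LieEnvelope.isLieAlgebra


/-- In a Lie algebra generated by the range of `g`, right-normed brackets span. -/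
theorem span_rightBracket_eq_top {k L X : Type*} [Field k] [LieRing L] [LieAlgebra k L]
    (g : X → L) (hg : LieSubalgebra.lieSpan k L (Set.range g) = ⊤) :
    Submodule.span k (Set.range fun l : List X => rightBracket (l.map g)) = ⊤ := by
  set W := Submodule.span k (Set.range fun l : List X => rightBracket (l.map g)) with hW
  have hgW : ∀ x, g x ∈ W := fun x => Submodule.subset_span ⟨[x], rfl⟩
  let N : LieSubalgebra k L :=
    { carrier := {x | ∀ y ∈ W, ⁅x, y⁆ ∈ W}
      add_mem' := fun {a b} ha hb y hy => by
        rw [add_lie]; exact W.add_mem (ha y hy) (hb y hy)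
      zero_mem' := fun y _ => by rw [zero_lie]; exact W.zero_mem
      smul_mem' := fun c a ha y hy => by
        rw [smul_lie]; exact W.smul_mem c (ha y hy)
      lie_mem' := fun {a b} ha hb y hy => by
        rw [lie_lie]
        exact W.sub_mem (ha _ (hb y hy)) (hb _ (ha y hy)) }
  have hN : ∀ x : L, x ∈ N := by
    have h1 : LieSubalgebra.lieSpan k L (Set.range g) ≤ N := by
      rw [LieSubalgebra.lieSpan_le]
      rintro _ ⟨x, rfl⟩
      change ∀ y ∈ W, ⁅g x, y⁆ ∈ W
      intro y hy
      refine Submodule.span_induction (p := fun y _ => ⁅g x, y⁆ ∈ W) ?_ ?_ ?_ ?_ hy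
      · rintro _ ⟨l, rfl⟩
        cases l with
        | nil => simp [rightBracket]
        | cons a l => exact Submodule.subset_span ⟨x :: a :: l, rfl⟩
      · rw [lie_zero]; exact W.zero_mem
      · intro a b _ _ ha hb; rw [lie_add]; exact W.add_mem ha hb
      · intro c a _ ha; rw [lie_smul]; exact W.smul_mem c ha
    intro x
    exact h1 (by rw [hg]; trivial)
  let K : LieSubalgebra k L := { W with lie_mem' := fun {a b} _ hb => hN a b hb }
  have h2 : LieSubalgebra.lieSpan k L (Set.range g) ≤ K := by
    rw [LieSubalgebra.lieSpan_le]
    rintro _ ⟨x, rfl⟩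
    exact hgW x
  rw [eq_top_iff]
  intro x _
  exact h2 (show x ∈ LieSubalgebra.lieSpan k L (Set.range g) by rw [hg]; trivial)

/-- The free Lie algebra is generated by its generators. -/
theorem freeLie_lieSpan (k X : Type*) [Field k] :
    LieSubalgebra.lieSpan k (FreeLieAlgebra k X) (Set.range (FreeLieAlgebra.of k)) = ⊤ := by
  set K := LieSubalgebra.lieSpan k (FreeLieAlgebra k X) (Set.range (FreeLieAlgebra.of k))
  let r : FreeLieAlgebra k X →ₗ⁅k⁆ K := FreeLieAlgebra.lift k
    (fun x => ⟨FreeLieAlgebra.of k x, LieSubalgebra.subset_lieSpan ⟨x, rfl⟩⟩)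
  have h : K.incl.comp r = LieHom.id := by
    apply FreeLieAlgebra.hom_ext
    intro x
    simp [r]
  rw [eq_top_iff]
  intro x _
  have hx : ((r x : K) : FreeLieAlgebra k X) = x := congrArg (fun f => f x) h
  rw [← hx]
  exact (r x).2

theorem map_rightBracket {k L L' : Type*} [Field k] [LieRing L] [LieAlgebra k L]
    [LieRing L'] [LieAlgebra k L'] (f : L →ₗ⁅k⁆ L') :
    ∀ l : List L, f (rightBracket l) = rightBracket (l.map f)
  | [] => by simp [rightBracket]
  | [x] => rfl
  | x :: y :: ys => by
    have := map_rightBracket f (y :: ys)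
    simp only [rightBracket, List.map_cons, LieHom.map_lie] at this ⊢
    rw [this]

theorem lift_surjective {k X L : Type*} [Field k] [LieRing L] [LieAlgebra k L]
    (g : X → L) (hg : LieSubalgebra.lieSpan k L (Set.range g) = ⊤) :
    Function.Surjective (FreeLieAlgebra.lift k g) := by
  intro y
  have h : LieSubalgebra.lieSpan k L (Set.range g) ≤ (FreeLieAlgebra.lift k g).range := by
    rw [LieSubalgebra.lieSpan_le]
    rintro _ ⟨x, rfl⟩
    exact ⟨FreeLieAlgebra.of k x, FreeLieAlgebra.lift_of_apply g x⟩
  have hy : y ∈ (FreeLieAlgebra.lift k g).range := h (by rw [hg]; trivial)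
  exact hy

theorem LieEnvelope.mem_h_iff {k s : Type*} [Field k] [AddCommGroup s] [Module k s]
    {q : ∀ n : ℕ, MultilinearMap k (fun _ : Fin n => s) s} (E : LieEnvelope k s q)
    (z : E.carrier) : z ∈ E.h ↔ E.π z = 0 := by
  refine ⟨E.π_eq_zero z, fun hz => ?_⟩
  have hz' : z ∈ E.h.toSubmodule ⊔ LinearMap.range E.ι := by
    rw [E.compl.sup_eq_top]; trivial
  obtain ⟨a, ha, b, hb, rfl⟩ := Submodule.mem_sup.1 hz'
  rw [map_add, E.π_eq_zero a ha, E.π_eq_self b hb, zero_add] at hz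
  rw [hz, add_zero]
  exact ha

theorem LieEnvelope.π_list {k s : Type*} [Field k] [AddCommGroup s] [Module k s]
    {q : ∀ n : ℕ, MultilinearMap k (fun _ : Fin n => s) s} (E : LieEnvelope k s q)
    (l : List s) (hl : l ≠ []) :
    E.π (FreeLieAlgebra.lift k E.ι (rightBracket (l.map (FreeLieAlgebra.of k))))
      = E.ι (q l.length l.get) := by
  rw [← E.proj_bracket l.length (List.length_pos_iff.2 hl), map_rightBracket]
  congr 2
  apply List.ext_get
  · simp
  · intro i h1 h2
    simp

theorem lieEnvelope_common {k s : Type*} [Field k] [AddCommGroup s] [Module k s]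
    {q : ∀ n : ℕ, MultilinearMap k (fun _ : Fin n => s) s} (E₁ E₂ : LieEnvelope k s q)
    (z : FreeLieAlgebra k s) :
    ∃ v : s, E₁.π (FreeLieAlgebra.lift k E₁.ι z) = E₁.ι v ∧
      E₂.π (FreeLieAlgebra.lift k E₂.ι z) = E₂.ι v := by
  have hz : z ∈ Submodule.span k
      (Set.range fun l : List s => rightBracket (l.map (FreeLieAlgebra.of k))) := by
    rw [span_rightBracket_eq_top _ (freeLie_lieSpan k s)]; trivial
  refine Submodule.span_induction (p := fun z _ =>
    ∃ v : s, E₁.π (FreeLieAlgebra.lift k E₁.ι z) = E₁.ι v ∧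
      E₂.π (FreeLieAlgebra.lift k E₂.ι z) = E₂.ι v) ?_ ?_ ?_ ?_ hz
  · rintro _ ⟨l, rfl⟩
    by_cases hl : l = []
    · subst hl
      exact ⟨0, by simp [rightBracket]⟩
    · exact ⟨_, E₁.π_list l hl, E₂.π_list l hl⟩
  · exact ⟨0, by simp⟩
  · rintro a b _ _ ⟨v, h1, h2⟩ ⟨w, h3, h4⟩
    exact ⟨v + w, by simp [h1, h3], by simp [h2, h4]⟩
  · rintro c a _ ⟨v, h1, h2⟩
    exact ⟨c • v, by simp [h1], by simp [h2]⟩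

theorem lieEnvelope_ker_le {k s : Type*} [Field k] [AddCommGroup s] [Module k s]
    {q : ∀ n : ℕ, MultilinearMap k (fun _ : Fin n => s) s} (E₁ E₂ : LieEnvelope k s q)
    (hgen₂ : LieSubalgebra.lieSpan k E₂.carrier (Set.range E₂.ι) = ⊤)
    (hmin₂ : ∀ I : LieIdeal k E₂.carrier, (∀ z ∈ I, z ∈ E₂.h) → I = ⊥)
    (z : FreeLieAlgebra k s) (hz : FreeLieAlgebra.lift k E₁.ι z = 0) :
    FreeLieAlgebra.lift k E₂.ι z = 0 := by
  set f₁ := FreeLieAlgebra.lift k E₁.ι with hf₁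
  set f₂ := FreeLieAlgebra.lift k E₂.ι with hf₂
  have hs : Function.Surjective f₂ := lift_surjective E₂.ι hgen₂
  have hI : LieIdeal.map f₂ f₁.ker = ⊥ := by
    apply hmin₂
    intro y hy
    obtain ⟨⟨w, hw⟩, rfl⟩ := LieIdeal.mem_map_of_surjective hs hy
    rw [LieHom.mem_ker] at hw
    obtain ⟨v, h1, h2⟩ := lieEnvelope_common E₁ E₂ w
    rw [E₂.mem_h_iff]
    rw [← hf₁, hw, map_zero] at h1
    have hv : v = 0 := E₁.ι_injective (by rw [← h1, map_zero])
    rw [hv, map_zero] at h2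
    exact h2
  have hm : f₂ z ∈ LieIdeal.map f₂ f₁.ker := LieIdeal.mem_map (by rwa [LieHom.mem_ker])
  rw [hI] at hm
  simpa using hm

/-- Uniqueness of the standard Lie envelope: any two Lie envelopes of `(s, (qₙ))` which
are generated as Lie algebras by the image of `s` and contain no nonzero Lie ideal
inside the complementary subalgebra `h` are isomorphic via an isomorphism commuting
with the embeddings of `s`. -/
theorem lieEnvelope_unique {k s : Type*} [Field k] [AddCommGroup s] [Module k s]
    (q : ∀ n : ℕ, MultilinearMap k (fun _ : Fin n => s) s)
    (hq1 : ∀ x : Fin 1 → s, q 1 x = x 0)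
    (henv : EnvelopeIdentities k s q)
    (E₁ E₂ : LieEnvelope k s q)
    (hgen₁ : LieSubalgebra.lieSpan k E₁.carrier (Set.range E₁.ι) = ⊤)
    (hgen₂ : LieSubalgebra.lieSpan k E₂.carrier (Set.range E₂.ι) = ⊤)
    (hmin₁ : ∀ I : LieIdeal k E₁.carrier, (∀ z ∈ I, z ∈ E₁.h) → I = ⊥)
    (hmin₂ : ∀ I : LieIdeal k E₂.carrier, (∀ z ∈ I, z ∈ E₂.h) → I = ⊥) :
    ∃ φ : E₁.carrier ≃ₗ⁅k⁆ E₂.carrier, ∀ v : s, φ (E₁.ι v) = E₂.ι v := by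
  set f₁ := FreeLieAlgebra.lift k E₁.ι with hf₁
  set f₂ := FreeLieAlgebra.lift k E₂.ι with hf₂
  have hs₁ : Function.Surjective f₁ := lift_surjective E₁.ι hgen₁
  have hs₂ : Function.Surjective f₂ := lift_surjective E₂.ι hgen₂
  have hker : LinearMap.ker (f₁ : FreeLieAlgebra k s →ₗ[k] E₁.carrier)
      = LinearMap.ker (f₂ : FreeLieAlgebra k s →ₗ[k] E₂.carrier) := by
    ext z
    exact ⟨lieEnvelope_ker_le E₁ E₂ hgen₂ hmin₂ z, lieEnvelope_ker_le E₂ E₁ hgen₁ hmin₁ z⟩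
  let e : E₁.carrier ≃ₗ[k] E₂.carrier :=
    (LinearMap.quotKerEquivOfSurjective (f₁ : FreeLieAlgebra k s →ₗ[k] E₁.carrier) hs₁).symm ≪≫ₗ
      Submodule.quotEquivOfEq _ _ hker ≪≫ₗ
      LinearMap.quotKerEquivOfSurjective (f₂ : FreeLieAlgebra k s →ₗ[k] E₂.carrier) hs₂
  have he : ∀ z, e (f₁ z) = f₂ z := by
    intro z
    have h := LinearMap.quotKerEquivOfSurjective_symm_apply
      (f := (f₁ : FreeLieAlgebra k s →ₗ[k] E₁.carrier)) hs₁ z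
    have h' : (LinearMap.quotKerEquivOfSurjective
      (f₁ : FreeLieAlgebra k s →ₗ[k] E₁.carrier) hs₁).symm (f₁ z) = Submodule.Quotient.mk z := h
    simp only [e, LinearEquiv.trans_apply, h']
    rfl
  refine ⟨{ (e : E₁.carrier →ₗ[k] E₂.carrier) with
    map_lie' := ?_
    invFun := e.symm
    left_inv := e.left_inv
    right_inv := e.right_inv }, ?_⟩
  · intro x y
    obtain ⟨a, rfl⟩ := hs₁ x
    obtain ⟨b, rfl⟩ := hs₁ y
    change e ⁅f₁ a, f₁ b⁆ = ⁅e (f₁ a), e (f₁ b)⁆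
    rw [← LieHom.map_lie, he, he, he, LieHom.map_lie]
  · intro v
    change e (E₁.ι v) = E₂.ι v
    have h1 : f₁ (FreeLieAlgebra.of k v) = E₁.ι v := FreeLieAlgebra.lift_of_apply _ v
    have h2 : f₂ (FreeLieAlgebra.of k v) = E₂.ι v := FreeLieAlgebra.lift_of_apply _ v
    rw [← h1, he, h2]
end

section
/- Let k be a field and s a k-vector space equipped with multilinear operations qₙ (n ≥ 2), with q₁(x) = x, satisfying the envelope identities. Then q₂ is antisymmetric, i.e. q₂(x₁, x₂) + q₂(x₂, x₁) = 0 for all x₁, x₂ ∈ s, and q₃ satisfies the cyclic (Jacobi-type) identity q₃(x₁, x₂, x₃) + q₃(x₂, x₃, x₁) + q₃(x₃, x₁, x₂) = 0 for all x₁, x₂, x₃ ∈ s. -/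
open scoped Classical

/-- If the multilinear operations `(qₙ)` (with `q₁ = id`) satisfy the envelope
identities, then `q₂` is antisymmetric and `q₃` satisfies the cyclic Jacobi-type
identity. -/
theorem q2_antisymm_and_q3_jacobi {k s : Type*} [Field k] [AddCommGroup s] [Module k s]
    (q : ∀ n : ℕ, MultilinearMap k (fun _ : Fin n => s) s)
    (hq1 : ∀ x : Fin 1 → s, q 1 x = x 0)
    (henv : EnvelopeIdentities k s q) :
    (∀ x₁ x₂ : s, q 2 ![x₁, x₂] + q 2 ![x₂, x₁] = 0) ∧
    (∀ x₁ x₂ x₃ : s,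
      q 3 ![x₁, x₂, x₃] + q 3 ![x₂, x₃, x₁] + q 3 ![x₃, x₁, x₂] = 0) := by
  have h11 : ∀ a b : s, q 2 ![a, b] + q 2 ![b, a] = 0 := by
    intro a b
    have h := henv 1 1 le_rfl le_rfl ![a] ![b]
    have hS : (Finset.univ.filter
          (fun σ : Equiv.Perm (Fin 1) × Fin 1 => IsUnimodalPeak σ.1 σ.2.val))
          = {(1, 0)} := by
      ext ⟨σ, p⟩
      have e1 : σ = 1 := Subsingleton.elim _ _
      have e2 : p = 0 := Subsingleton.elim _ _
      subst e1 e2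
      simp [IsUnimodalPeak]
    rw [hS, Finset.sum_singleton, hq1, hq1] at h
    have e1 : (Fin.cons a ![b] : Fin 2 → s) = ![a, b] := rfl
    have e2 : (Fin.cons b ![a] : Fin 2 → s) = ![b, a] := rfl
    have e3 : Fin.append (fun i : Fin 1 => (![a] : Fin 1 → s) ((1 : Equiv.Perm (Fin 1)) i)) ![b]
        = ![a, b] := by
      funext i; fin_cases i <;> rfl
    erw [e1, e2, e3] at h
    simp at h
    rw [← h]; abel
  have h21 : ∀ a b y : s, q 3 ![y, a, b] + q 3 ![a, b, y] = q 3 ![b, a, y] := by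
    intro a b y
    have h := henv 2 1 (by norm_num) le_rfl ![a, b] ![y]
    have hS : (Finset.univ.filter
          (fun σ : Equiv.Perm (Fin 2) × Fin 2 => IsUnimodalPeak σ.1 σ.2.val))
          = {(1, 1), (Equiv.swap 0 1, 0)} := by
      ext ⟨σ, p⟩
      have hσ : σ = 1 ∨ σ = Equiv.swap 0 1 := by
        revert σ; decide
      have key : IsUnimodalPeak σ p.val ↔
          ((0 < p.val → σ 0 < σ 1) ∧ (p.val ≤ 0 → σ 1 < σ 0)) := by
        constructor
        · rintro ⟨_, h1, h2⟩
          exact ⟨h1 0 (by norm_num), h2 0 (by norm_num)⟩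
        · rintro ⟨h1, h2⟩
          refine ⟨p.2, ?_, ?_⟩
          · intro j hj
            obtain rfl : j = 0 := by omega
            exact h1
          · intro j hj
            obtain rfl : j = 0 := by omega
            exact h2
      have hne : (1 : Equiv.Perm (Fin 2)) ≠ Equiv.swap 0 1 := by decide
      simp only [Finset.mem_filter, Finset.mem_univ, true_and, key, Finset.mem_insert,
        Finset.mem_singleton, Prod.mk.injEq]
      rcases hσ with rfl | rfl <;> fin_cases p <;> simp [hne, hne.symm]
    have hne : ((1, 1) : Equiv.Perm (Fin 2) × Fin 2) ≠ (Equiv.swap 0 1, 0) := by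
      intro h; simp at h
    rw [hS, Finset.sum_pair hne, hq1] at h
    have e0 : (Fin.cons (q 2 ![a, b]) ![y] : Fin 2 → s) = ![q 2 ![a, b], y] := rfl
    have e1 : (Fin.cons y ![a, b] : Fin 3 → s) = ![y, a, b] := rfl
    have e2 : Fin.append (fun i : Fin 2 => (![a, b] : Fin 2 → s) ((1 : Equiv.Perm (Fin 2)) i)) ![y]
        = ![a, b, y] := by
      funext i; fin_cases i <;> rfl
    have e3 : Fin.append (fun i : Fin 2 => (![a, b] : Fin 2 → s)
        ((Equiv.swap 0 1 : Equiv.Perm (Fin 2)) i)) ![y] = ![b, a, y] := by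
      funext i; fin_cases i <;> rfl
    erw [e0, e1, e2, e3] at h
    simp at h
    have h' : q 3 ![y, a, b] = - (q 3 ![a, b, y] + - q 3 ![b, a, y]) := by
      rw [← h]; abel
    rw [h']; abel
  refine ⟨h11, fun a b c => ?_⟩
  have A := h21 a b c
  have B := h21 a c b
  have C := h21 c a b
  have D : q 3 ![b, a, c] + q 3 ![b, c, a] = 0 := by
    grind
  grind
end
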